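/- For every nonnegative integer n and every nonzero real k, the spherical Bessel function satisfies |j_n(k)| ≤ 1/√|k|. -/

import Mathlib

/-- The spherical Bessel function of the first kind, j_n(k) = √(π/(2k)) J_{n+1/2}(k),
defined through its power series (valid for all real k). -/
noncomputable def sphericalBessel (n : ℕ) (k : ℝ) : ℝ :=
  ∑' m : ℕ, (-1)^m * Real.sqrt Real.pi /
    (2 * (Nat.factorial m : ℝ) * Real.Gamma ((m:ℝ) + n + 3/2)) * (k/2)^(2*m+n)

open Real Set Filter Topology

/-! ### The power series -/

/-- The coefficients of `z ↦ (k / 2) ^ (-n) * j_n(k)` as a power series in `z = k ^ 2 / 4`. -/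
noncomputable def besselCoeff (n m : ℕ) : ℝ :=
  (-1) ^ m * √π / (2 * (Nat.factorial m : ℝ) * Real.Gamma ((m : ℝ) + n + 3 / 2))

/-- The entire function with `j_n(k) = (k / 2) ^ n * besselEntire n (k ^ 2 / 4)`. -/
noncomputable def besselEntire (n : ℕ) (z : ℝ) : ℝ := ∑' m : ℕ, besselCoeff n m * z ^ m

lemma Gamma_nat_add_three_halves_pos (l : ℕ) : 0 < Real.Gamma ((l : ℝ) + 3 / 2) :=
  Real.Gamma_pos_of_pos (by positivity)

lemma Gamma_nat_succ_add_three_halves (l : ℕ) :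
    Real.Gamma ((l : ℝ) + 1 + 3 / 2) = (l + 3 / 2) * Real.Gamma ((l : ℝ) + 3 / 2) := by
  rw [← Real.Gamma_add_one (by positivity)]
  congr 1
  ring

lemma Gamma_three_halves : Real.Gamma (3 / 2) = √π / 2 := by
  rw [show (3 / 2 : ℝ) = 1 / 2 + 1 by norm_num, Real.Gamma_add_one (by norm_num),
    Real.Gamma_one_half_eq]
  ring

lemma factorial_mul_le_Gamma (l : ℕ) :
    √π / 2 * (Nat.factorial l : ℝ) ≤ Real.Gamma ((l : ℝ) + 3 / 2) := by
  induction l with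
  | zero => simp [Gamma_three_halves]
  | succ l ih =>
    push_cast [Nat.factorial_succ]
    rw [Gamma_nat_succ_add_three_halves]
    calc √π / 2 * ((l + 1) * (Nat.factorial l : ℝ))
        = (l + 1) * (√π / 2 * (Nat.factorial l : ℝ)) := by ring
      _ ≤ (l + 3 / 2) * Real.Gamma ((l : ℝ) + 3 / 2) := by gcongr; norm_num

lemma abs_besselCoeff_le (n m : ℕ) :
    |besselCoeff n m| ≤ 1 / (Nat.factorial n : ℝ) * (1 / (Nat.factorial m : ℝ)) := by
  have hG := factorial_mul_le_Gamma (m + n)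
  have hGp := Gamma_nat_add_three_halves_pos (m + n)
  push_cast at hG hGp
  have hπ : 0 < √π := by positivity
  have hfac : (Nat.factorial n : ℝ) ≤ (Nat.factorial (m + n) : ℝ) := by
    exact_mod_cast Nat.factorial_le (Nat.le_add_left n m)
  have hn : 0 < (Nat.factorial n : ℝ) := by positivity
  have hm : 0 < (Nat.factorial m : ℝ) := by positivity
  rw [besselCoeff, abs_div, abs_mul, abs_pow, abs_neg, abs_one, one_pow, one_mul,
    abs_of_pos hπ, abs_of_pos (by positivity), div_mul_div_comm, one_mul,
    div_le_div_iff₀ (by positivity) (by positivity), one_mul]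
  have : √π / 2 * (Nat.factorial n : ℝ) ≤ Real.Gamma ((m : ℝ) + n + 3 / 2) :=
    le_trans (by gcongr) hG
  nlinarith

lemma norm_besselCoeff_mul_pow_le (n m : ℕ) (z : ℝ) :
    ‖besselCoeff n m * z ^ m‖ ≤
      1 / (Nat.factorial n : ℝ) * (|z| ^ m / (Nat.factorial m : ℝ)) := by
  rw [Real.norm_eq_abs, abs_mul, abs_pow]
  calc |besselCoeff n m| * |z| ^ m
      ≤ 1 / (Nat.factorial n : ℝ) * (1 / (Nat.factorial m : ℝ)) * |z| ^ m := by
        gcongr; exact abs_besselCoeff_le n m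
    _ = _ := by ring

lemma summable_besselCoeff_mul_pow (n : ℕ) (z : ℝ) :
    Summable fun m : ℕ => besselCoeff n m * z ^ m :=
  .of_norm_bounded ((Real.summable_pow_div_factorial |z|).mul_left _)
    fun m => norm_besselCoeff_mul_pow_le n m z

lemma abs_besselEntire_le (n : ℕ) (z : ℝ) :
    |besselEntire n z| ≤ Real.exp |z| / (Nat.factorial n : ℝ) := by
  have h : HasSum (fun m : ℕ => |z| ^ m / (Nat.factorial m : ℝ)) (Real.exp |z|) := by
    rw [Real.exp_eq_exp_ℝ]
    exact NormedSpace.expSeries_div_hasSum_exp |z|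
  refine (tsum_of_norm_bounded (h.mul_left _)
    fun m => norm_besselCoeff_mul_pow_le n m z).trans_eq ?_
  ring

lemma besselCoeff_succ_mul (n m : ℕ) :
    besselCoeff n (m + 1) * ((m : ℝ) + 1) = -besselCoeff (n + 1) m := by
  have hG := Gamma_nat_add_three_halves_pos (m + n + 1)
  push_cast at hG
  simp only [besselCoeff, Nat.factorial_succ]
  push_cast
  rw [show (m : ℝ) + 1 + n + 3 / 2 = m + n + 1 + 3 / 2 by ring, ← add_assoc]
  field_simp
  ring

lemma besselCoeff_add (n m : ℕ) :
    besselCoeff n (m + 1) + besselCoeff (n + 2) m =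
      ((n : ℝ) + 3 / 2) * besselCoeff (n + 1) (m + 1) := by
  have hG := Gamma_nat_add_three_halves_pos (m + n + 1)
  have h := Gamma_nat_succ_add_three_halves (m + n + 1)
  push_cast at hG h
  simp only [besselCoeff, Nat.factorial_succ]
  push_cast
  rw [show (m : ℝ) + 1 + n + 3 / 2 = m + n + 1 + 3 / 2 by ring,
    show (m : ℝ) + 1 + (n + 1) + 3 / 2 = m + n + 1 + 1 + 3 / 2 by ring,
    show (m : ℝ) + (n + 2) + 3 / 2 = m + n + 1 + 1 + 3 / 2 by ring, h]
  have : (0 : ℝ) < m + n + 1 + 3 / 2 := by positivity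
  field_simp
  ring

lemma besselCoeff_zero_right (n : ℕ) :
    besselCoeff n 0 = ((n : ℝ) + 3 / 2) * besselCoeff (n + 1) 0 := by
  have hG := Gamma_nat_add_three_halves_pos n
  simp only [besselCoeff]
  push_cast
  rw [zero_add, zero_add, Gamma_nat_succ_add_three_halves]
  field_simp

lemma besselEntire_recurrence (n : ℕ) (z : ℝ) :
    besselEntire n z + z * besselEntire (n + 2) z =
      ((n : ℝ) + 3 / 2) * besselEntire (n + 1) z := by
  have hs (l : ℕ) := (summable_nat_add_iff 1).2 (summable_besselCoeff_mul_pow l z)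
  simp only [besselEntire]
  rw [(summable_besselCoeff_mul_pow n z).tsum_eq_zero_add,
    (summable_besselCoeff_mul_pow (n + 1) z).tsum_eq_zero_add, add_assoc, ← tsum_mul_left,
    ← (hs n).tsum_add ((summable_besselCoeff_mul_pow (n + 2) z).mul_left z), mul_add,
    ← tsum_mul_left, besselCoeff_zero_right, mul_assoc]
  congr 1
  refine tsum_congr fun m => ?_
  linear_combination z ^ (m + 1) * besselCoeff_add n m

lemma hasDerivAt_besselEntire (n : ℕ) (z : ℝ) :
    HasDerivAt (besselEntire n) (-besselEntire (n + 1) z) z := by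
  have hz : z ∈ Metric.ball (0 : ℝ) (|z| + 1) := by simp
  have hd (m : ℕ) (y : ℝ) : HasDerivAt (fun x => besselCoeff n (m + 1) * x ^ (m + 1))
      (-(besselCoeff (n + 1) m * y ^ m)) y := by
    convert! ((hasDerivAt_pow (m + 1) y).const_mul (besselCoeff n (m + 1))) using 1
    push_cast
    linear_combination -y ^ m * besselCoeff_succ_mul n m
  have h := hasDerivAt_tsum_of_isPreconnected
    ((Real.summable_pow_div_factorial (|z| + 1)).mul_left (1 / (Nat.factorial (n + 1) : ℝ)))
    Metric.isOpen_ball (convex_ball (0 : ℝ) (|z| + 1)).isPreconnected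
    (fun m y _ => hd m y) (fun m y hy => ?_) hz
    ((summable_nat_add_iff 1).2 (summable_besselCoeff_mul_pow n z)) hz
  · rw [tsum_neg] at h
    refine (h.const_add (besselCoeff n 0)).congr_of_eventuallyEq (.of_forall fun x => ?_)
    simp only [besselEntire]
    rw [(summable_besselCoeff_mul_pow n x).tsum_eq_zero_add, pow_zero, mul_one]
  · rw [norm_neg]
    refine (norm_besselCoeff_mul_pow_le (n + 1) m y).trans ?_
    have : |y| ≤ |z| + 1 := by simpa using (mem_ball_zero_iff.1 hy).le
    gcongr

/-! ### Spherical Bessel functions -/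

lemma sphericalBessel_eq (n : ℕ) (k : ℝ) :
    sphericalBessel n k = (k / 2) ^ n * besselEntire n (k ^ 2 / 4) := by
  rw [sphericalBessel, besselEntire, ← tsum_mul_left]
  refine tsum_congr fun m => ?_
  rw [besselCoeff, pow_add, pow_mul, div_pow k 2 2]
  norm_num
  ring

lemma abs_sphericalBessel_abs (n : ℕ) (k : ℝ) :
    |sphericalBessel n (|k|)| = |sphericalBessel n k| := by
  simp [sphericalBessel_eq, abs_mul, abs_div, abs_pow]

lemma abs_sphericalBessel_le (n : ℕ) {t K : ℝ} (ht : 0 ≤ t) (htK : t ≤ K) :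
    |sphericalBessel n t| ≤ (K / 2) ^ n / (Nat.factorial n : ℝ) * Real.exp (K ^ 2 / 4) := by
  have hK : 0 ≤ K := ht.trans htK
  rw [sphericalBessel_eq, abs_mul, abs_of_nonneg (by positivity)]
  have h := abs_besselEntire_le n (t ^ 2 / 4)
  rw [abs_of_nonneg (by positivity : 0 ≤ t ^ 2 / 4)] at h
  calc (t / 2) ^ n * |besselEntire n (t ^ 2 / 4)|
      ≤ (K / 2) ^ n * (Real.exp (K ^ 2 / 4) / (Nat.factorial n : ℝ)) := by
        refine mul_le_mul (by gcongr) (h.trans ?_) (abs_nonneg _) (by positivity)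
        gcongr
    _ = _ := by ring

lemma sphericalBessel_recurrence (n : ℕ) (t : ℝ) :
    t * (sphericalBessel n t + sphericalBessel (n + 2) t) =
      (2 * n + 3) * sphericalBessel (n + 1) t := by
  simp only [sphericalBessel_eq]
  linear_combination (t / 2) ^ n * t * besselEntire_recurrence n (t ^ 2 / 4)

lemma continuous_sphericalBessel (n : ℕ) : Continuous (sphericalBessel n) := by
  have h : Continuous (besselEntire n) :=
    continuous_iff_continuousAt.2 fun z => (hasDerivAt_besselEntire n z).continuousAt
  rw [funext (sphericalBessel_eq n)]
  fun_prop

lemma hasDerivAt_sphericalBessel (n : ℕ) {t : ℝ} (ht : t ≠ 0) :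
    HasDerivAt (sphericalBessel n)
      (n / t * sphericalBessel n t - sphericalBessel (n + 1) t) t := by
  have h1 : HasDerivAt (fun x : ℝ => (x / 2) ^ n) (n * (t / 2) ^ (n - 1) * (1 / 2)) t :=
    ((hasDerivAt_id t).div_const 2).pow n
  have h2 : HasDerivAt (fun x : ℝ => x ^ 2 / 4) (t / 2) t := by
    convert! ((hasDerivAt_pow 2 t).div_const 4) using 1
    norm_num
    ring
  have h3 := h1.mul ((hasDerivAt_besselEntire n (t ^ 2 / 4)).comp t h2)
  rw [funext (sphericalBessel_eq n)]
  convert! h3 using 1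
  simp only [sphericalBessel_eq, Function.comp_apply]
  rcases n with _ | n
  · simp
    ring
  · rw [Nat.add_sub_cancel]
    push_cast
    field_simp
    ring

lemma besselCoeff_zero_left (m : ℕ) :
    besselCoeff 0 m = (-1) ^ m * 4 ^ m / (Nat.factorial (2 * m + 1) : ℝ) := by
  induction m with
  | zero =>
    have : √π ≠ 0 := by positivity
    simp [besselCoeff, Gamma_three_halves]
    field_simp
  | succ m ih =>
    have hG := Gamma_nat_add_three_halves_pos m
    have hs : besselCoeff 0 (m + 1) * ((m + 1) * (m + 3 / 2)) = -besselCoeff 0 m := by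
      simp only [besselCoeff, Nat.factorial_succ]
      push_cast
      rw [add_zero, add_zero, Gamma_nat_succ_add_three_halves]
      field_simp
      ring
    have hpos : ((m : ℝ) + 1) * (m + 3 / 2) ≠ 0 := by positivity
    rw [← mul_left_inj' hpos, hs, ih, show 2 * (m + 1) + 1 = 2 * m + 1 + 1 + 1 by ring]
    simp only [Nat.factorial_succ]
    push_cast
    field_simp
    ring

lemma mul_sphericalBessel_zero (t : ℝ) : t * sphericalBessel 0 t = Real.sin t := by
  rw [sphericalBessel_eq, pow_zero, one_mul, besselEntire, Real.sin_eq_tsum, ← tsum_mul_left]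
  refine tsum_congr fun m => ?_
  rw [besselCoeff_zero_left, div_pow, ← pow_mul, pow_succ]
  field_simp

lemma sphericalBessel_zero_sub_mul_one {t : ℝ} (ht : t ≠ 0) :
    sphericalBessel 0 t - t * sphericalBessel 1 t = Real.cos t := by
  have h := (hasDerivAt_id t).mul (hasDerivAt_sphericalBessel 0 ht)
  have h2 : HasDerivAt Real.sin _ t :=
    h.congr_of_eventuallyEq (.of_forall fun x => (mul_sphericalBessel_zero x).symm)
  rw [← h2.unique (Real.hasDerivAt_sin t)]
  simp
  ring

/-- The derivative of `t * ∑ j_n(t) ^ 2` telescopes. -/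
lemma hasDerivAt_sum_mul_sphericalBessel_sq (N : ℕ) {t : ℝ} (ht : t ≠ 0) :
    HasDerivAt (fun x => ∑ n ∈ Finset.range (N + 1), x * sphericalBessel n x ^ 2)
      (Real.sin (2 * t) / (2 * t) - t * (sphericalBessel N t * sphericalBessel (N + 1) t)) t := by
  have hd (n : ℕ) := (hasDerivAt_id t).mul ((hasDerivAt_sphericalBessel n ht).pow 2)
  induction N with
  | zero =>
    simp only [zero_add, Finset.sum_range_one]
    convert! hd 0 using 1
    rw [Real.sin_two_mul, ← mul_sphericalBessel_zero t, ← sphericalBessel_zero_sub_mul_one ht]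
    simp
    field_simp
    ring
  | succ N ih =>
    simp only [Finset.sum_range_succ _ (N + 1)]
    convert! ih.add (hd (N + 1)) using 1
    have h := sphericalBessel_recurrence N t
    simp
    field_simp
    linear_combination (2 * t * sphericalBessel (N + 1) t) * h

/-! ### An upper bound for the sine integral -/

lemma sub_le_sub_of_deriv_le {f f' g g' : ℝ → ℝ} {a b : ℝ} (hab : a ≤ b)
    (hf : ContinuousOn f (Icc a b)) (hg : ContinuousOn g (Icc a b))
    (hf' : ∀ x ∈ Ioo a b, HasDerivAt f (f' x) x) (hg' : ∀ x ∈ Ioo a b, HasDerivAt g (g' x) x)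
    (h : ∀ x ∈ Ioo a b, f' x ≤ g' x) : f b - f a ≤ g b - g a := by
  have hm : MonotoneOn (fun x => g x - f x) (Icc a b) := by
    refine monotoneOn_of_hasDerivWithinAt_nonneg (f' := fun x => g' x - f' x) (convex_Icc a b)
      (hg.sub hf) (fun x hx => ?_) fun x hx => ?_
    · rw [interior_Icc] at hx
      exact ((hg' x hx).sub (hf' x hx)).hasDerivWithinAt
    · rw [interior_Icc] at hx
      exact sub_nonneg.2 (h x hx)
  have := hm (left_mem_Icc.2 hab) (right_mem_Icc.2 hab) hab
  simp only at this
  linarith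

lemma le_of_hasDerivAt_le {f f' g g' : ℝ → ℝ} (hf : ∀ x, HasDerivAt f (f' x) x)
    (hg : ∀ x, HasDerivAt g (g' x) x) (h0 : f 0 = g 0) (h : ∀ x, 0 ≤ x → f' x ≤ g' x)
    {x : ℝ} (hx : 0 ≤ x) : f x ≤ g x := by
  have := sub_le_sub_of_deriv_le hx (fun y _ => (hf y).continuousAt.continuousWithinAt)
    (fun y _ => (hg y).continuousAt.continuousWithinAt) (fun y _ => hf y) (fun y _ => hg y)
    fun y hy => h y hy.1.le
  linarith

lemma sin_le_taylor_nine {x : ℝ} (hx : 0 ≤ x) :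
    Real.sin x ≤ x - x ^ 3 / 6 + x ^ 5 / 120 - x ^ 7 / 5040 + x ^ 9 / 362880 := by
  have hc (x : ℝ) : HasDerivAt (fun y => -Real.cos y) (Real.sin x) x := by
    have h := (Real.hasDerivAt_cos x).neg
    rw [neg_neg] at h
    exact h
  have hs (x : ℝ) : HasDerivAt (fun y => -Real.sin y) (-Real.cos x) x :=
    (Real.hasDerivAt_sin x).neg
  have hp (n : ℕ) (c x : ℝ) :
      HasDerivAt (fun y : ℝ => y ^ (n + 1) / c) ((n + 1) * x ^ n / c) x := by
    simpa using (hasDerivAt_pow (n + 1) x).div_const c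
  have h2 {x : ℝ} (hx : 0 ≤ x) : -Real.cos x ≤ -1 + x ^ 2 / 2 :=
    le_of_hasDerivAt_le hc (fun x => (hp 1 2 x).const_add (-1)) (by simp)
      (fun x hx => (Real.sin_le hx).trans_eq (by norm_num)) hx
  have h3 {x : ℝ} (hx : 0 ≤ x) : -Real.sin x ≤ -x + x ^ 3 / 6 :=
    le_of_hasDerivAt_le hs (fun x => (hasDerivAt_id x).neg.add (hp 2 6 x)) (by simp)
      (fun x hx => (h2 hx).trans_eq (by norm_num; ring)) hx
  have h4 {x : ℝ} (hx : 0 ≤ x) : Real.cos x ≤ 1 - x ^ 2 / 2 + x ^ 4 / 24 :=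
    le_of_hasDerivAt_le Real.hasDerivAt_cos
      (fun x => ((hp 1 2 x).const_sub 1).add (hp 3 24 x)) (by simp)
      (fun x hx => (h3 hx).trans_eq (by norm_num; ring)) hx
  have h5 {x : ℝ} (hx : 0 ≤ x) : Real.sin x ≤ x - x ^ 3 / 6 + x ^ 5 / 120 :=
    le_of_hasDerivAt_le Real.hasDerivAt_sin
      (fun x => ((hasDerivAt_id x).sub (hp 2 6 x)).add (hp 4 120 x)) (by simp)
      (fun x hx => (h4 hx).trans_eq (by norm_num; ring)) hx
  have h6 {x : ℝ} (hx : 0 ≤ x) : -Real.cos x ≤ -1 + x ^ 2 / 2 - x ^ 4 / 24 + x ^ 6 / 720 :=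
    le_of_hasDerivAt_le hc
      (fun x => (((hp 1 2 x).const_add (-1)).sub (hp 3 24 x)).add (hp 5 720 x)) (by simp)
      (fun x hx => (h5 hx).trans_eq (by norm_num; ring)) hx
  have h7 {x : ℝ} (hx : 0 ≤ x) : -Real.sin x ≤ -x + x ^ 3 / 6 - x ^ 5 / 120 + x ^ 7 / 5040 :=
    le_of_hasDerivAt_le hs
      (fun x => (((hasDerivAt_id x).neg.add (hp 2 6 x)).sub (hp 4 120 x)).add (hp 6 5040 x))
      (by simp) (fun x hx => (h6 hx).trans_eq (by norm_num; ring)) hx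
  have h8 {x : ℝ} (hx : 0 ≤ x) :
      Real.cos x ≤ 1 - x ^ 2 / 2 + x ^ 4 / 24 - x ^ 6 / 720 + x ^ 8 / 40320 :=
    le_of_hasDerivAt_le Real.hasDerivAt_cos
      (fun x => ((((hp 1 2 x).const_sub 1).add (hp 3 24 x)).sub (hp 5 720 x)).add
        (hp 7 40320 x)) (by simp)
      (fun x hx => (h7 hx).trans_eq (by norm_num; ring)) hx
  exact le_of_hasDerivAt_le Real.hasDerivAt_sin
      (fun x => ((((hasDerivAt_id x).sub (hp 2 6 x)).add (hp 4 120 x)).sub (hp 6 5040 x)).add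
        (hp 8 362880 x)) (by simp)
      (fun x hx => (h8 hx).trans_eq (by norm_num; ring)) hx

/-- The Taylor polynomial of degree nine of the sine integral at `0`. -/
noncomputable def sinIntegralTaylor (x : ℝ) : ℝ :=
  x - x ^ 3 / 18 + x ^ 5 / 600 - x ^ 7 / 35280 + x ^ 9 / 3265920

lemma hasDerivAt_sinIntegralTaylor (x : ℝ) :
    HasDerivAt sinIntegralTaylor
      (1 - x ^ 2 / 6 + x ^ 4 / 120 - x ^ 6 / 5040 + x ^ 8 / 362880) x := by
  have hp (n : ℕ) (c : ℝ) :
      HasDerivAt (fun y : ℝ => y ^ (n + 1) / c) ((n + 1) * x ^ n / c) x := by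
    simpa using (hasDerivAt_pow (n + 1) x).div_const c
  refine (((((hasDerivAt_id x).sub (hp 2 18)).add (hp 4 600)).sub (hp 6 35280)).add
    (hp 8 3265920)).congr_deriv ?_
  norm_num
  ring

lemma sin_div_le_deriv_sinIntegralTaylor {x : ℝ} (hx : 0 < x) :
    Real.sin x / x ≤ 1 - x ^ 2 / 6 + x ^ 4 / 120 - x ^ 6 / 5040 + x ^ 8 / 362880 := by
  rw [div_le_iff₀ hx]
  exact (sin_le_taylor_nine hx.le).trans_eq (by ring)

lemma sinIntegralTaylor_le_pi {x : ℝ} (hx : 0 ≤ x) (hxπ : x ≤ π) :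
    sinIntegralTaylor x ≤ sinIntegralTaylor π := by
  have h := sub_le_sub_of_deriv_le (f := fun _ => 0) (f' := fun _ => 0) hxπ continuousOn_const
    (fun y _ => (hasDerivAt_sinIntegralTaylor y).continuousAt.continuousWithinAt)
    (fun y _ => hasDerivAt_const y 0) (fun y _ => hasDerivAt_sinIntegralTaylor y)
    fun y hy => ?_
  · linarith
  · have hy0 : 0 < y := hx.trans_lt hy.1
    exact (div_nonneg (Real.sin_nonneg_of_nonneg_of_le_pi hy0.le hy.2.le) hy0.le).trans
      (sin_div_le_deriv_sinIntegralTaylor hy0)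

lemma sinIntegralTaylor_pi_lt : sinIntegralTaylor π < 1.86 := by
  have h1 := Real.pi_gt_d4
  have h2 := Real.pi_lt_d4
  have l3 : (3.1415 : ℝ) ^ 3 ≤ π ^ 3 := by gcongr
  have l7 : (3.1415 : ℝ) ^ 7 ≤ π ^ 7 := by gcongr
  have u5 : π ^ 5 ≤ (3.1416 : ℝ) ^ 5 := by gcongr
  have u9 : π ^ 9 ≤ (3.1416 : ℝ) ^ 9 := by gcongr
  rw [sinIntegralTaylor]
  norm_num at l3 l7 u5 u9 ⊢
  linarith

/-- A function whose derivative dominates `sin x / x`, used for `π ≤ x`. -/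
noncomputable def sinIntegralTail (x : ℝ) : ℝ := -(Real.cos x / x) - (Real.sin x + 1) / x ^ 2

lemma hasDerivAt_sinIntegralTail {x : ℝ} (hx : x ≠ 0) :
    HasDerivAt sinIntegralTail (Real.sin x / x + 2 * (Real.sin x + 1) / x ^ 3) x := by
  refine (((Real.hasDerivAt_cos x).div (hasDerivAt_id x) hx).neg.sub
    (((Real.hasDerivAt_sin x).add_const 1).div (hasDerivAt_pow 2 x)
      (pow_ne_zero 2 hx))).congr_deriv ?_
  simp
  field_simp
  ring

lemma sin_div_le_deriv_sinIntegralTail {x : ℝ} (hx : 0 < x) :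
    Real.sin x / x ≤ Real.sin x / x + 2 * (Real.sin x + 1) / x ^ 3 := by
  have : 0 ≤ Real.sin x + 1 := by linarith [Real.neg_one_le_sin x]
  exact le_add_of_nonneg_right (by positivity)

lemma sinIntegralTail_sub_pi_le {x : ℝ} (hx : π ≤ x) :
    sinIntegralTail x - sinIntegralTail π ≤ 0.12 := by
  have hπ := Real.pi_gt_three
  have hx0 : 0 < x := by linarith
  have h1 : -(Real.cos x / x) ≤ 1 / π := by
    rw [← neg_div]
    exact div_le_div₀ zero_le_one (by linarith [Real.neg_one_le_cos x]) Real.pi_pos hx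
  have h2 : 0 ≤ (Real.sin x + 1) / x ^ 2 :=
    div_nonneg (by linarith [Real.neg_one_le_sin x]) (by positivity)
  have h3 : 1 / π ^ 2 ≤ 0.12 := by
    rw [div_le_iff₀ (by positivity)]
    nlinarith
  simp only [sinIntegralTail, Real.cos_pi, Real.sin_pi, zero_add, neg_div, neg_neg]
  linarith

/-! ### The uniform bound -/

lemma sum_mul_sphericalBessel_sq_sub_le (N : ℕ) {a b ε : ℝ} (ha : 0 ≤ a) (hab : a ≤ b)
    (hε : ∀ t ∈ Ioo a b, -(t * (sphericalBessel N t * sphericalBessel (N + 1) t)) ≤ ε)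
    {g g' : ℝ → ℝ} (hc : ContinuousOn g (Icc (2 * a) (2 * b)))
    (hg : ∀ x ∈ Ioo (2 * a) (2 * b), HasDerivAt g (g' x) x)
    (hsin : ∀ x ∈ Ioo (2 * a) (2 * b), Real.sin x / x ≤ g' x) :
    ∑ n ∈ Finset.range (N + 1), b * sphericalBessel n b ^ 2 -
        ∑ n ∈ Finset.range (N + 1), a * sphericalBessel n a ^ 2 ≤
      (g (2 * b) - g (2 * a)) / 2 + ε * (b - a) := by
  have hmem {x : ℝ} (hx : x ∈ Ioo a b) : 2 * x ∈ Ioo (2 * a) (2 * b) :=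
    ⟨by linarith [hx.1], by linarith [hx.2]⟩
  have h := sub_le_sub_of_deriv_le (g := fun x => g (2 * x) / 2 + ε * x)
    (g' := fun x => g' (2 * x) + ε) hab
    (f := fun x => ∑ n ∈ Finset.range (N + 1), x * sphericalBessel n x ^ 2) ?_ ?_
    (fun x hx => hasDerivAt_sum_mul_sphericalBessel_sq N (ha.trans_lt hx.1).ne')
    (fun x hx => ?_) fun x hx => ?_
  · refine h.trans_eq ?_
    ring
  · have := continuous_sphericalBessel
    fun_prop
  · have : ContinuousOn (fun x => g (2 * x)) (Icc a b) :=
      hc.comp (by fun_prop) fun x hx => ⟨by linarith [hx.1], by linarith [hx.2]⟩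
    exact (this.div_const 2).add (by fun_prop)
  · have h2 : HasDerivAt (fun y : ℝ => 2 * y) 2 x := by
      simpa using (hasDerivAt_id x).const_mul 2
    have hε : HasDerivAt (fun y : ℝ => ε * y) ε x := by
      simpa using (hasDerivAt_id x).const_mul ε
    refine ((((hg _ (hmem hx)).comp x h2).div_const 2).add hε).congr_deriv ?_
    ring
  · have := hsin _ (hmem hx)
    have := hε x hx
    linarith

lemma sum_mul_sphericalBessel_sq_le (N : ℕ) {k ε : ℝ} (hk : 0 ≤ k)
    (hε : ∀ t ∈ Ioo 0 k, -(t * (sphericalBessel N t * sphericalBessel (N + 1) t)) ≤ ε) :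
    ∑ n ∈ Finset.range (N + 1), k * sphericalBessel n k ^ 2 ≤ 1 + ε * k := by
  have hfirst {b : ℝ} (hb : 0 ≤ b) (hbk : b ≤ k) (hbπ : 2 * b ≤ π) :
      ∑ n ∈ Finset.range (N + 1), b * sphericalBessel n b ^ 2 ≤ 0.93 + ε * b := by
    have h := sum_mul_sphericalBessel_sq_sub_le N le_rfl hb
      (fun t ht => hε t ⟨ht.1, ht.2.trans_le hbk⟩)
      (fun x _ => (hasDerivAt_sinIntegralTaylor x).continuousAt.continuousWithinAt)
      (fun x _ => hasDerivAt_sinIntegralTaylor x)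
      fun x hx => sin_div_le_deriv_sinIntegralTaylor (by linarith [hx.1])
    have h0 : sinIntegralTaylor (2 * 0) = 0 := by simp [sinIntegralTaylor]
    have h1 := sinIntegralTaylor_le_pi (by positivity) hbπ
    have h2 := sinIntegralTaylor_pi_lt
    rw [h0] at h
    simp only [zero_mul, Finset.sum_const_zero, sub_zero] at h
    linarith
  rcases le_total (2 * k) π with hkπ | hkπ
  · linarith [hfirst hk le_rfl hkπ]
  · have hπ := Real.pi_pos
    have hπk : π / 2 ≤ k := by linarith
    have h1 := hfirst (by positivity) hπk (by linarith)
    have hne {x : ℝ} (hx : 2 * (π / 2) ≤ x) : 0 < x := by linarith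
    have h2 := sum_mul_sphericalBessel_sq_sub_le N (by positivity) hπk
      (fun t ht => hε t ⟨by linarith [ht.1], ht.2⟩)
      (fun x hx => (hasDerivAt_sinIntegralTail (hne hx.1).ne').continuousAt.continuousWithinAt)
      (fun x hx => hasDerivAt_sinIntegralTail (hne hx.1.le).ne')
      fun x hx => sin_div_le_deriv_sinIntegralTail (hne hx.1.le)
    have h3 := sinIntegralTail_sub_pi_le hkπ
    rw [mul_div_cancel₀ π two_ne_zero] at h2
    linarith

lemma mul_sphericalBessel_sq_le_one (n : ℕ) {k : ℝ} (hk : 0 ≤ k) :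
    k * sphericalBessel n k ^ 2 ≤ 1 := by
  let A (N : ℕ) : ℝ := (k / 2) ^ N / (Nat.factorial N : ℝ) * Real.exp (k ^ 2 / 4)
  have hA : Tendsto A atTop (𝓝 0) := by
    simpa using (FloorSemiring.tendsto_pow_div_factorial_atTop (k / 2)).mul_const _
  have hlim : Tendsto (fun N => 1 + k * (A N * A (N + 1)) * k) atTop (𝓝 1) := by
    simpa using
      (((hA.mul (hA.comp (tendsto_add_atTop_nat 1))).const_mul k).mul_const k).const_add 1
  refine ge_of_tendsto hlim ?_
  filter_upwards [eventually_ge_atTop n] with N hN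
  have hsum := sum_mul_sphericalBessel_sq_le N (ε := k * (A N * A (N + 1))) hk fun t ht => ?_
  · exact (Finset.single_le_sum (f := fun n => k * sphericalBessel n k ^ 2)
      (fun i _ => by positivity) (Finset.mem_range.2 (by omega))).trans hsum
  · refine (neg_le_abs _).trans ?_
    rw [abs_mul, abs_mul, abs_of_pos ht.1]
    gcongr
    · exact ht.2.le
    · exact abs_sphericalBessel_le N ht.1.le ht.2.le
    · exact abs_sphericalBessel_le (N + 1) ht.1.le ht.2.le

/-- |j_n(k)| ≤ 1/√|k| for all n ∈ ℕ₀ and nonzero real k. -/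
theorem stmt7 (n : ℕ) (k : ℝ) (hk : k ≠ 0) :
    |sphericalBessel n k| ≤ 1 / Real.sqrt |k| := by
  have hk' : 0 < |k| := abs_pos.2 hk
  rw [← abs_sphericalBessel_abs, ← Real.sqrt_one, ← Real.sqrt_div zero_le_one]
  refine Real.abs_le_sqrt ?_
  rw [le_div_iff₀ hk', mul_comm]
  exact mul_sphericalBessel_sq_le_one n hk'.le
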